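/- arXiv:0804.0699 — 5 statements merged into one kernel-verified Lean document; each statement's English description precedes it below -/
import Mathlib

section
/- Let X be a Hausdorff topological space, f : X → X a homeomorphism, and φ : X → ℝ a continuous function with the Lyapunov property for f. Let p be a periodic point of f with f^[k](p) = p for some integer k ≥ 1, and let x ≠ p be a point such that (f⁻¹)^[m·k](x) → p as m → ∞ (i.e. x ∈ W^u(p) \ {p}). Then x is not a periodic point of f and φ(x) < φ(p). (Lemma 2.1, part 2, unstable case.) -/
open Filter Topology

/-- **Lemma 2.1, part 2 (unstable case).** If `φ` is a continuous Lyapunov function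
for a homeomorphism `f` of a Hausdorff space, `p` is a periodic point of period `k`,
and `x ≠ p` lies in the unstable set of `p` (i.e. `(f⁻¹)^[m·k] x → p`), then `x` is
not periodic and `φ x < φ p`. -/
theorem lyapunov_lt_on_unstable {X : Type*} [TopologicalSpace X] [T2Space X]
    (f : X ≃ₜ X) (φ : X → ℝ) (hφ : Continuous φ)
    (hlt : ∀ x ∉ Function.periodicPts f, φ (f x) < φ x)
    (heq : ∀ x ∈ Function.periodicPts f, φ (f x) = φ x)
    (p : X) (k : ℕ) (hk : 1 ≤ k) (hp : (⇑f)^[k] p = p)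
    (x : X) (hxp : x ≠ p)
    (hxu : Tendsto (fun m : ℕ => (⇑f.symm)^[m * k] x) atTop (𝓝 p)) :
    x ∉ Function.periodicPts ⇑f ∧ φ x < φ p := by
  have hnp : x ∉ Function.periodicPts ⇑f := by
    rintro ⟨n, hn, hper⟩
    have hinv : (⇑f.symm)^[n] x = x := by
      have h1 : (⇑f)^[n] x = x := hper
      have h2 : (⇑f.symm)^[n] ((⇑f)^[n] x) = x :=
        (Function.LeftInverse.iterate f.symm_apply_apply n) x
      rwa [h1] at h2
    have hsub : Tendsto (fun j : ℕ => j * n) atTop atTop :=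
      tendsto_id.atTop_mul_const' hn
    have h3 := hxu.comp hsub
    have h4 : ((fun m : ℕ => (⇑f.symm)^[m * k] x) ∘ fun j : ℕ => j * n) = fun _ => x := by
      funext j
      have h5 : Function.IsPeriodicPt (⇑f.symm) n x := hinv
      have h6 := h5.mul_const (j * k)
      have h7 : j * n * k = n * (j * k) := by ring
      simp only [Function.comp_apply, h7]
      exact h6
    rw [h4] at h3
    exact hxp (tendsto_nhds_unique tendsto_const_nhds h3)
  refine ⟨hnp, ?_⟩
  have hnp' : f.symm x ∉ Function.periodicPts ⇑f := by
    rintro ⟨n, hn, hper⟩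
    apply hnp
    refine ⟨n, hn, ?_⟩
    have h1 : (⇑f)^[n] (f.symm x) = f.symm x := hper
    have h2 : (⇑f)^[n] (f (f.symm x)) = f (f.symm x) := by
      rw [← Function.iterate_succ_apply, Function.iterate_succ_apply', h1]
    rw [f.apply_symm_apply] at h2
    exact h2
  have hstep : φ x < φ (f.symm x) := by
    simpa using hlt _ hnp'
  have hle : ∀ y, φ y ≤ φ (f.symm y) := by
    intro y
    by_cases h : f.symm y ∈ Function.periodicPts ⇑f
    · simpa using (heq _ h).le
    · simpa using (hlt _ h).le
  have hmono : Monotone fun n : ℕ => φ ((⇑f.symm)^[n] x) := by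
    refine monotone_nat_of_le_succ fun n => ?_
    rw [Function.iterate_succ_apply']
    exact hle _
  refine hstep.trans_le (ge_of_tendsto ((hφ.tendsto p).comp hxu) ?_)
  filter_upwards [eventually_ge_atTop 1] with m hm
  exact hmono (Nat.mul_pos hm hk : 1 ≤ m * k)
end

section
/- Let X be a Hausdorff topological space, f : X → X a homeomorphism, and φ : X → ℝ a continuous function with the Lyapunov property for f. Let p be a periodic point of f with f^[k](p) = p for some integer k ≥ 1, and let x ≠ p be a point such that f^[m·k](x) → p as m → ∞ (i.e. x ∈ W^s(p) \ {p}). Then x is not a periodic point of f and φ(x) > φ(p). (Lemma 2.1, part 2, stable case.) -/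
open Filter Topology

/-- **Lemma 2.1, part 2 (stable case).** If `φ` is a continuous Lyapunov function
for a homeomorphism `f` of a Hausdorff space, `p` is a periodic point of period `k`,
and `x ≠ p` lies in the stable set of `p` (i.e. `f^[m·k] x → p`), then `x` is
not periodic and `φ x > φ p`. -/
theorem lyapunov_gt_on_stable {X : Type*} [TopologicalSpace X] [T2Space X]
    (f : X ≃ₜ X) (φ : X → ℝ) (hφ : Continuous φ)
    (hlt : ∀ x ∉ Function.periodicPts f, φ (f x) < φ x)
    (heq : ∀ x ∈ Function.periodicPts f, φ (f x) = φ x)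
    (p : X) (k : ℕ) (hk : 1 ≤ k) (hp : (⇑f)^[k] p = p)
    (x : X) (hxp : x ≠ p)
    (hxs : Tendsto (fun m : ℕ => (⇑f)^[m * k] x) atTop (𝓝 p)) :
    x ∉ Function.periodicPts ⇑f ∧ φ p < φ x := by
  have hx : x ∉ Function.periodicPts ⇑f := by
    rintro ⟨n, hn, hper⟩
    have h1 : Tendsto (fun j : ℕ => j * n) atTop atTop :=
      tendsto_id.atTop_mul_const' hn
    have h2 := hxs.comp h1
    have h3 : ((fun m : ℕ => (⇑f)^[m * k] x) ∘ fun j : ℕ => j * n) = fun _ => x := by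
      funext j
      have h4 : Function.IsPeriodicPt (⇑f) (j * k * n) x := hper.const_mul (j * k)
      have h5 : j * n * k = j * k * n := by ring
      simp only [Function.comp_apply, h5]
      exact h4
    rw [h3] at h2
    exact hxp (tendsto_nhds_unique tendsto_const_nhds h2)
  refine ⟨hx, ?_⟩
  have hle : ∀ y, φ (f y) ≤ φ y := fun y => by
    by_cases hy : y ∈ Function.periodicPts ⇑f
    · exact (heq y hy).le
    · exact (hlt y hy).le
  have hanti : Antitone (fun n : ℕ => φ ((⇑f)^[n] x)) := by
    refine antitone_nat_of_succ_le fun n => ?_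
    rw [Function.iterate_succ_apply']
    exact hle _
  refine lt_of_le_of_lt ?_ (hlt x hx)
  refine le_of_tendsto ((hφ.tendsto p).comp hxs) ?_
  filter_upwards [eventually_ge_atTop 1] with m hm
  exact hanti (show 1 ≤ m * k from Nat.mul_pos hm hk)
end

section
/- Let X be a Hausdorff topological space, f : X → X a homeomorphism, and φ : X → ℝ a continuous function with the Lyapunov property for f. Let p and q be periodic points of f with p ≠ q, f^[k_p](p) = p and f^[k_q](q) = q for integers k_p, k_q ≥ 1, and let z be a point such that (f⁻¹)^[m·k_p](z) → p and f^[m·k_q](z) → q as m → ∞ (i.e. z ∈ W^u(p) ∩ W^s(q)). Then φ(q) < φ(z) < φ(p); in particular φ(q) < φ(p). (This is the key step in the proof of Lemma 3.1: a Morse–Smale diffeomorphism possessing a self-indexing energy function, i.e. one with φ(p) = dim W^u(p) at every periodic point, is gradient-like.) -/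
open Filter Topology

/-- Key step in the proof of Lemma 3.1: if `φ` is a continuous Lyapunov function
for a homeomorphism `f` of a Hausdorff space, `p ≠ q` are periodic points of
periods `k_p`, `k_q`, and `z ∈ W^u(p) ∩ W^s(q)`, then `φ q < φ z < φ p`; in
particular `φ q < φ p`. -/
theorem lyapunov_heteroclinic_lt {X : Type*} [TopologicalSpace X] [T2Space X]
    (f : X ≃ₜ X) (φ : X → ℝ) (hφ : Continuous φ)
    (hlt : ∀ x ∉ Function.periodicPts f, φ (f x) < φ x)
    (heq : ∀ x ∈ Function.periodicPts f, φ (f x) = φ x)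
    (p q : X) (hpq : p ≠ q)
    (kp kq : ℕ) (hkp : 1 ≤ kp) (hkq : 1 ≤ kq)
    (hp : (⇑f)^[kp] p = p) (hq : (⇑f)^[kq] q = q)
    (z : X)
    (hzu : Tendsto (fun m : ℕ => (⇑f.symm)^[m * kp] z) atTop (𝓝 p))
    (hzs : Tendsto (fun m : ℕ => (⇑f)^[m * kq] z) atTop (𝓝 q)) :
    φ q < φ z ∧ φ z < φ p ∧ φ q < φ p := by
  have hle : ∀ x, φ (f x) ≤ φ x := fun x => by
    by_cases h : x ∈ Function.periodicPts f
    · exact (heq x h).le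
    · exact (hlt x h).le
  have key : ∀ (g : X → X) (n k : ℕ) (a : X), 0 < n → g^[n] z = z →
      Tendsto (fun m : ℕ => g^[m * k] z) atTop (𝓝 a) → z = a := by
    intro g n k a hn hg ht
    have h1 : Tendsto (fun m : ℕ => n * m) atTop atTop :=
      tendsto_id.const_mul_atTop' hn
    have h2 := ht.comp h1
    have h3 : ((fun m : ℕ => g^[m * k] z) ∘ fun m : ℕ => n * m) = fun _ => z := by
      funext m
      simp only [Function.comp]
      rw [mul_assoc, Function.iterate_mul]
      exact Function.iterate_fixed hg _
    rw [h3] at h2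
    exact tendsto_nhds_unique tendsto_const_nhds h2
  have hz : z ∉ Function.periodicPts f := by
    rintro ⟨n, hn, hzn⟩
    have hzn' : (⇑f)^[n] z = z := hzn
    have hsn : (⇑f.symm)^[n] z = z := by
      have h := (Function.LeftInverse.iterate f.symm_apply_apply n) z
      rwa [hzn'] at h
    exact hpq ((key _ n kp p hn hsn hzu).symm.trans (key _ n kq q hn hzn' hzs))
  have hz' : f.symm z ∉ Function.periodicPts f := by
    rintro ⟨n, hn, h⟩
    apply hz
    refine ⟨n, hn, ?_⟩
    have := h.apply
    rwa [f.apply_symm_apply] at this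
  have hanti : Antitone (fun i : ℕ => φ ((⇑f)^[i] z)) := by
    apply antitone_nat_of_succ_le
    intro i
    rw [Function.iterate_succ_apply']
    exact hle _
  have hmono : Monotone (fun i : ℕ => φ ((⇑f.symm)^[i] z)) := by
    apply monotone_nat_of_le_succ
    intro i
    rw [Function.iterate_succ_apply']
    simpa using hle (f.symm ((⇑f.symm)^[i] z))
  have hq1 : φ q ≤ φ (f z) := by
    refine le_of_tendsto ((hφ.tendsto q).comp hzs) ?_
    filter_upwards [eventually_ge_atTop 1] with m hm
    exact hanti (show 1 ≤ m * kq from Nat.mul_pos hm hkq)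
  have hp1 : φ (f.symm z) ≤ φ p := by
    refine ge_of_tendsto ((hφ.tendsto p).comp hzu) ?_
    filter_upwards [eventually_ge_atTop 1] with m hm
    exact hmono (show 1 ≤ m * kp from Nat.mul_pos hm hkp)
  have a := hlt z hz
  have b := hlt _ hz'
  rw [f.apply_symm_apply] at b
  exact ⟨by linarith, by linarith, by linarith⟩
end

section
/- Let E and F be real normed vector spaces, λ a real number with 0 < λ < 1, A : E → E a continuous linear bijection with ‖A⁻¹(w)‖ ≤ λ‖w‖ for all w ∈ E, and B : F → F a continuous linear map with ‖B(v)‖ ≤ λ‖v‖ for all v ∈ F. Let g : E × F → E × F satisfy g(0) = 0 and be differentiable at 0 with derivative D(u, v) = (A(u), B(v)). Fix q ∈ ℝ and define φ(u, v) = q − ‖u‖² + ‖v‖². Then there exists a neighborhood U of 0 in E × F such that φ(g(x)) < φ(x) for every x ∈ U with x ≠ 0. (Lemma 2.2: since f(v) = Df(v) + o(v), the quadratic Lyapunov function built from a Lyapunov metric strictly decreases under f on a sufficiently small neighborhood of the hyperbolic periodic orbit, away from the orbit itself.) -/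
open Filter Topology

/-- **Lemma 2.2.** If `g` fixes `0` and is differentiable at `0` with hyperbolic
derivative `(u, v) ↦ (A u, B v)`, where `A` expands and `B` contracts with rate
`0 < λ < 1`, then the quadratic Lyapunov function `φ(u, v) = q − ‖u‖² + ‖v‖²`
strictly decreases under `g` on a sufficiently small punctured neighborhood of `0`. -/
theorem quadratic_lyapunov_near_hyperbolic_fixed_point
    {E F : Type*} [NormedAddCommGroup E] [NormedSpace ℝ E]
    [NormedAddCommGroup F] [NormedSpace ℝ F]
    (lam : ℝ) (hlam0 : 0 < lam) (hlam1 : lam < 1)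
    (A : E ≃L[ℝ] E) (hA : ∀ w : E, ‖A.symm w‖ ≤ lam * ‖w‖)
    (B : F →L[ℝ] F) (hB : ∀ v : F, ‖B v‖ ≤ lam * ‖v‖)
    (g : E × F → E × F) (hg0 : g 0 = 0)
    (hg : HasFDerivAt g ((A : E →L[ℝ] E).prodMap B) 0)
    (q : ℝ) :
    ∃ U ∈ 𝓝 (0 : E × F), ∀ x ∈ U, x ≠ 0 →
      q - ‖(g x).1‖ ^ 2 + ‖(g x).2‖ ^ 2 < q - ‖x.1‖ ^ 2 + ‖x.2‖ ^ 2 := by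
  have key : ∀ d a b m P Q : ℝ, 0 < d → d < 1 → 0 ≤ a → 0 ≤ b → 0 < m → a ≤ m → b ≤ m →
      m ^ 2 ≤ a ^ 2 + b ^ 2 → 0 ≤ P → 0 ≤ Q → (1 + d) * a - d / 8 * m ≤ P →
      Q ≤ (1 - d) * b + d / 8 * m → a ^ 2 + Q ^ 2 < P ^ 2 + b ^ 2 := by
    intro d a b m P Q hd hd1 ha hb hm ham hbm hmab hP hQ hP1 hQ1
    have hdm : 0 < d * m := mul_pos hd hm
    have h1 : ((1 + d) * a) ^ 2 - 2 * ((1 + d) * a) * (d / 8 * m) ≤ P ^ 2 := by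
      rcases le_total ((1 + d) * a) (d / 8 * m) with h | h
      · have : 0 ≤ (1 + d) * a := by positivity
        nlinarith [sq_nonneg P]
      · have := pow_le_pow_left₀ (by linarith) hP1 2
        nlinarith [sq_nonneg (d / 8 * m)]
    have h2 : Q ^ 2 ≤ ((1 - d) * b + d / 8 * m) ^ 2 := pow_le_pow_left₀ hQ hQ1 2
    have h3 : 2 * ((1 + d) * a) * (d / 8 * m) ≤ d / 2 * m ^ 2 := by
      have : (1 + d) * a ≤ 2 * m := by nlinarith
      nlinarith
    have h4 : ((1 - d) * b + d / 8 * m) ^ 2 ≤ (1 - d) * b ^ 2 + 3 * d / 8 * m ^ 2 := by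
      have e1 : (1 - d) * b ≤ m := by nlinarith
      have e2 : (1 - d) * b * (d / 8 * m) ≤ m * (d / 8 * m) :=
        mul_le_mul_of_nonneg_right e1 (by positivity)
      have e3 : (1 - d) ^ 2 * b ^ 2 ≤ (1 - d) * b ^ 2 :=
        mul_le_mul_of_nonneg_right (by nlinarith) (by positivity)
      have e4 : (d / 8) ^ 2 * m ^ 2 ≤ d / 8 * m ^ 2 :=
        mul_le_mul_of_nonneg_right (by nlinarith) (by positivity)
      nlinarith
    have h5 : (1 + 2 * d) * a ^ 2 ≤ ((1 + d) * a) ^ 2 := by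
      nlinarith [sq_nonneg (d * a)]
    have h6 : d * m ^ 2 ≤ d * (a ^ 2 + b ^ 2) := mul_le_mul_of_nonneg_left hmab hd.le
    have h7 : 0 < d * m ^ 2 := by positivity
    have h8 : 0 ≤ d * a ^ 2 := by positivity
    nlinarith
  have hd : 0 < 1 - lam := by linarith
  have ho := (hasFDerivAt_iff_isLittleO_nhds_zero.mp hg).def
    (show 0 < (1 - lam) / 8 by positivity)
  refine ⟨_, ho, fun x hx hx0 => ?_⟩
  simp only [Set.mem_setOf_eq, zero_add, hg0, sub_zero] at hx
  have hx1 := (norm_fst_le _).trans hx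
  have hx2 := (norm_snd_le _).trans hx
  simp only [Prod.fst_sub, Prod.snd_sub, ContinuousLinearMap.coe_prodMap', Prod.map_fst,
    Prod.map_snd, ContinuousLinearEquiv.coe_coe] at hx1 hx2
  have hA' := hA (A x.1)
  rw [A.symm_apply_apply] at hA'
  have t1 : ‖A x.1‖ ≤ ‖(g x).1‖ + ‖(g x).1 - A x.1‖ := by
    have := norm_sub_le (g x).1 ((g x).1 - A x.1)
    simpa using this
  have t2 : ‖(g x).2‖ ≤ ‖B x.2‖ + ‖(g x).2 - B x.2‖ := by
    have := norm_add_le (B x.2) ((g x).2 - B x.2)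
    simpa using this
  have t3 : (1 + (1 - lam)) * ‖x.1‖ ≤ ‖A x.1‖ := by
    nlinarith [mul_nonneg (sq_nonneg (1 - lam)) (norm_nonneg (A x.1))]
  have hm : ‖x‖ ^ 2 ≤ ‖x.1‖ ^ 2 + ‖x.2‖ ^ 2 := by
    rw [Prod.norm_def]
    rcases max_choice ‖x.1‖ ‖x.2‖ with h | h <;> rw [h] <;>
      nlinarith [sq_nonneg ‖x.1‖, sq_nonneg ‖x.2‖]
  have := key (1 - lam) ‖x.1‖ ‖x.2‖ ‖x‖ ‖(g x).1‖ ‖(g x).2‖ hd (by linarith)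
    (norm_nonneg _) (norm_nonneg _) (norm_pos_iff.mpr hx0) (norm_fst_le x) (norm_snd_le x) hm
    (norm_nonneg _) (norm_nonneg _) (by linarith) (by linarith [hB x.2])
  linarith
end

section
/- Let E be a real normed vector space and φ : E → ℝ a function differentiable at a point p ∈ E. Let s, t ⊆ E be sets such that p is a local maximum of φ on s and a local minimum of φ on t. Suppose V and W are linear subspaces of E such that every vector of V belongs to the positive tangent cone of s at p, every vector of W belongs to the positive tangent cone of t at p, and V + W = E. Then the derivative of φ at p is the zero linear map, i.e. p is a critical point of φ. (The analytic content of Lemma 2.1, part 3: any periodic point of a Morse–Smale diffeomorphism is a critical point of any Lyapunov function, because the tangent spaces of the unstable and stable manifolds—on which φ has a maximum, respectively minimum—generate the whole tangent space.) -/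
/-- Analytic content of Lemma 2.1, part 3: if `φ` is differentiable at `p`, has a
local maximum at `p` on `s` and a local minimum at `p` on `t`, and there are linear
subspaces `V`, `W` contained respectively in the positive tangent cones of `s` and
`t` at `p` with `V + W = E`, then `p` is a critical point of `φ`. -/
theorem critical_point_of_localMaxOn_localMinOn
    {E : Type*} [NormedAddCommGroup E] [NormedSpace ℝ E]
    (φ : E → ℝ) (φ' : E →L[ℝ] ℝ) (p : E) (hφ : HasFDerivAt φ φ' p)
    (s t : Set E)
    (hmax : IsLocalMaxOn φ s p) (hmin : IsLocalMinOn φ t p)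
    (V W : Submodule ℝ E)
    (hV : ∀ v ∈ V, v ∈ posTangentConeAt s p)
    (hW : ∀ w ∈ W, w ∈ posTangentConeAt t p)
    (hVW : V ⊔ W = ⊤) :
    φ' = 0 := by
  ext x
  have hx : x ∈ V ⊔ W := by rw [hVW]; exact Submodule.mem_top
  obtain ⟨v, hv, w, hw, rfl⟩ := Submodule.mem_sup.mp hx
  have h1 : φ' v = 0 := hmax.hasFDerivWithinAt_eq_zero hφ.hasFDerivWithinAt
    (hV v hv) (hV (-v) (V.neg_mem hv))
  have h2 : φ' w = 0 := hmin.hasFDerivWithinAt_eq_zero hφ.hasFDerivWithinAt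
    (hW w hw) (hW (-w) (W.neg_mem hw))
  simp [h1, h2]
end
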